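/- Assume G is orderable and φ is cofinal. Then c₊(1) = 0 and c₋(1) = 0; for all t ∈ ℝ and ψ ∈ G one has c₊(φ(t)*ψ) = t + c₊(ψ), c₋(φ(t)*ψ) = t + c₋(ψ), c₊(ψ*φ(t)) = t + c₊(ψ) and c₋(ψ*φ(t)) = t + c₋(ψ); and whenever ψ ⪯ ψ' one has c₊(ψ) ≤ c₊(ψ') and c₋(ψ) ≤ c₋(ψ'). (Normalization and monotonicity of the selectors, Theorem 1.2(1)–(2) of the paper.) -/

import Mathlib

/-- The maximal order spectral selector `c₊`. -/
noncomputable def cplus {G : Type*} (r : G → G → Prop) (φ : ℝ → G) (ψ : G) : ℝ :=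
  sInf {t : ℝ | r ψ (φ t)}

/-- The minimal order spectral selector `c₋`. -/
noncomputable def cminus {G : Type*} (r : G → G → Prop) (φ : ℝ → G) (ψ : G) : ℝ :=
  sSup {t : ℝ | r (φ t) ψ}

theorem Real.sInf_setOf_sub_mem {S : Set ℝ} (hne : S.Nonempty) (hb : BddBelow S) (t : ℝ) :
    sInf {s | s - t ∈ S} = t + sInf S := by
  have h := (OrderIso.addLeft t).map_csInf' hne hb
  rw [OrderIso.image_eq_preimage_symm] at h
  simpa [Set.preimage, sub_eq_neg_add] using h.symm

theorem Real.sSup_setOf_sub_mem {S : Set ℝ} (hne : S.Nonempty) (hb : BddAbove S) (t : ℝ) :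
    sSup {s | s - t ∈ S} = t + sSup S := by
  have h := (OrderIso.addLeft t).map_csSup' hne hb
  rw [OrderIso.image_eq_preimage_symm] at h
  simpa [Set.preimage, sub_eq_neg_add] using h.symm

theorem biinvariant_mul_left_iff {G : Type*} [Group G] {r : G → G → Prop}
    (hbi : ∀ a b x y, r x y → r (a * x * b) (a * y * b)) (a x y : G) :
    r (a * x) (a * y) ↔ r x y :=
  ⟨fun h => by simpa using hbi a⁻¹ 1 _ _ h, fun h => by simpa using hbi a 1 _ _ h⟩

theorem biinvariant_mul_right_iff {G : Type*} [Group G] {r : G → G → Prop}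
    (hbi : ∀ a b x y, r x y → r (a * x * b) (a * y * b)) (b x y : G) :
    r (x * b) (y * b) ↔ r x y :=
  ⟨fun h => by simpa using hbi 1 b⁻¹ _ _ h, fun h => by simpa using hbi 1 b _ _ h⟩

/-- normalization and monotonicity of the order spectral selectors. -/
theorem stmt_1 {G : Type*} [Group G] (r : G → G → Prop)
    (hrefl : ∀ x, r x x)
    (htrans : ∀ x y z, r x y → r y z → r x z)
    (hbi : ∀ a b x y, r x y → r (a * x * b) (a * y * b))
    (φ : ℝ → G)
    (hφadd : ∀ s t : ℝ, φ (s + t) = φ s * φ t)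
    (hφinj : Function.Injective φ)
    (hφmono : ∀ s t : ℝ, s ≤ t → r (φ s) (φ t))
    (horder : ∀ x y, r x y → r y x → x = y)
    (hcof : ∀ ψ : G, ∃ s t : ℝ, r (φ s) ψ ∧ r ψ (φ t)) :
    cplus r φ (1 : G) = 0 ∧ cminus r φ (1 : G) = 0 ∧
    (∀ (t : ℝ) (ψ : G), cplus r φ (φ t * ψ) = t + cplus r φ ψ) ∧
    (∀ (t : ℝ) (ψ : G), cminus r φ (φ t * ψ) = t + cminus r φ ψ) ∧
    (∀ (t : ℝ) (ψ : G), cplus r φ (ψ * φ t) = t + cplus r φ ψ) ∧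
    (∀ (t : ℝ) (ψ : G), cminus r φ (ψ * φ t) = t + cminus r φ ψ) ∧
    (∀ ψ ψ' : G, r ψ ψ' →
      cplus r φ ψ ≤ cplus r φ ψ' ∧ cminus r φ ψ ≤ cminus r φ ψ') := by
  have hle : ∀ s t, r (φ s) (φ t) ↔ s ≤ t := by
    refine fun s t => ⟨fun h => ?_, hφmono s t⟩
    by_contra! hlt
    exact hlt.ne (hφinj (horder _ _ (hφmono t s hlt.le) h))
  have hone : φ 0 = 1 := by
    simpa using hφadd 0 0
  have hne_plus : ∀ ψ, {t | r ψ (φ t)}.Nonempty := fun ψ =>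
    let ⟨_, t, _, ht⟩ := hcof ψ
    ⟨t, ht⟩
  have hne_minus : ∀ ψ, {t | r (φ t) ψ}.Nonempty := fun ψ =>
    let ⟨s, _, hs, _⟩ := hcof ψ
    ⟨s, hs⟩
  have hbdd_plus : ∀ ψ, BddBelow {t | r ψ (φ t)} := fun ψ =>
    let ⟨s, _, hs, _⟩ := hcof ψ
    ⟨s, fun t ht => (hle s t).1 (htrans _ _ _ hs ht)⟩
  have hbdd_minus : ∀ ψ, BddAbove {t | r (φ t) ψ} := fun ψ =>
    let ⟨_, t, _, ht⟩ := hcof ψ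
    ⟨t, fun s hs => (hle s t).1 (htrans _ _ _ hs ht)⟩
  have hleft : ∀ s t, φ s = φ t * φ (s - t) := fun s t => by
    rw [← hφadd, add_sub_cancel]
  have hright : ∀ s t, φ s = φ (s - t) * φ t := fun s t => by
    rw [← hφadd, sub_add_cancel]
  refine ⟨?_, ?_, fun t ψ => ?_, fun t ψ => ?_, fun t ψ => ?_, fun t ψ => ?_,
    fun ψ ψ' h => ⟨?_, ?_⟩⟩
  · simp only [cplus, ← hone, hle]
    exact csInf_Ici
  · simp only [cminus, ← hone, hle]
    exact csSup_Iic
  · rw [cplus, cplus, ← Real.sInf_setOf_sub_mem (hne_plus ψ) (hbdd_plus ψ)]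
    congr 1
    ext s
    rw [Set.mem_ofPred_eq, hleft s t, biinvariant_mul_left_iff hbi]
    rfl
  · rw [cminus, cminus, ← Real.sSup_setOf_sub_mem (hne_minus ψ) (hbdd_minus ψ)]
    congr 1
    ext s
    rw [Set.mem_ofPred_eq, hleft s t, biinvariant_mul_left_iff hbi]
    rfl
  · rw [cplus, cplus, ← Real.sInf_setOf_sub_mem (hne_plus ψ) (hbdd_plus ψ)]
    congr 1
    ext s
    rw [Set.mem_ofPred_eq, hright s t, biinvariant_mul_right_iff hbi]
    rfl
  · rw [cminus, cminus, ← Real.sSup_setOf_sub_mem (hne_minus ψ) (hbdd_minus ψ)]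
    congr 1
    ext s
    rw [Set.mem_ofPred_eq, hright s t, biinvariant_mul_right_iff hbi]
    rfl
  · exact csInf_le_csInf (hbdd_plus ψ) (hne_plus ψ') fun t ht => htrans _ _ _ h ht
  · exact csSup_le_csSup (hbdd_minus ψ') (hne_minus ψ) fun t ht => htrans _ _ _ ht h
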